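/- Let A and B be associative unital k-algebras and let R: B⊗A → A⊗B and Q: A⊗B → A⊗B satisfy the L-R-twisted tensor product conditions. Then the L-R-twisted tensor product A _Q⊗_R B, namely the vector space A⊗B with multiplication (a⊗b)(a'⊗b') = a_Q a'_R ⊗ b_R b'_Q (R applied to b⊗a', Q applied to a⊗b'), is an associative unital algebra with unit 1_A⊗1_B. -/

import Mathlib

open TensorProduct LinearMap

noncomputable section

variable {k : Type*} [Field k]

section Helpers

variable {M N P Q : Type*}
  [AddCommMonoid M] [AddCommMonoid N] [AddCommMonoid P] [AddCommMonoid Q]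
  [Module k M] [Module k N] [Module k P] [Module k Q]

def aso : (M ⊗[k] N) ⊗[k] P →ₗ[k] M ⊗[k] (N ⊗[k] P) :=
  (TensorProduct.assoc k M N P).toLinearMap

def osa : M ⊗[k] (N ⊗[k] P) →ₗ[k] (M ⊗[k] N) ⊗[k] P :=
  (TensorProduct.assoc k M N P).symm.toLinearMap

def cc : M ⊗[k] N →ₗ[k] N ⊗[k] M := (TensorProduct.comm k M N).toLinearMap

def lc : M ⊗[k] (N ⊗[k] P) →ₗ[k] N ⊗[k] (M ⊗[k] P) :=
  (TensorProduct.leftComm k M N P).toLinearMap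

def tt : (M ⊗[k] N) ⊗[k] (P ⊗[k] Q) →ₗ[k] (M ⊗[k] P) ⊗[k] (N ⊗[k] Q) :=
  (TensorProduct.tensorTensorTensorComm k M N P Q).toLinearMap

end Helpers

section LRCrossed

variable (k)
variable (H U : Type*) [Ring H] [Algebra k H] [AddCommGroup U] [Module k U]

abbrev mH : H ⊗[k] H →ₗ[k] H := LinearMap.mul' k H

def dR : (H ⊗[k] H) ⊗[k] H →ₗ[k] H ⊗[k] H :=
  rTensor H (mH k H) ∘ₗ osa ∘ₗ lTensor H cc ∘ₗ aso

/-- `d ⊗ (g ⊗ i) ↦ (d*g) ⊗ i`. -/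
def dL : H ⊗[k] (H ⊗[k] H) →ₗ[k] H ⊗[k] H :=
  rTensor H (mH k H) ∘ₗ osa

/-- `(g ⊗ i) ⊗ d ↦ g ⊗ (d*i)`. -/
def eR : (H ⊗[k] H) ⊗[k] H →ₗ[k] H ⊗[k] H :=
  lTensor H ((mH k H) ∘ₗ cc) ∘ₗ aso

/-- `d ⊗ (g ⊗ i) ↦ g ⊗ (i*d)`. -/
def eL : H ⊗[k] (H ⊗[k] H) →ₗ[k] H ⊗[k] H :=
  lTensor H ((mH k H) ∘ₗ cc) ∘ₗ lc

/-- `(g ⊗ i) ⊗ (a ⊗ b) ↦ (g*a) ⊗ (b*i)`. -/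
def mulLR : (H ⊗[k] H) ⊗[k] (H ⊗[k] H) →ₗ[k] H ⊗[k] H :=
  TensorProduct.map (mH k H) ((mH k H) ∘ₗ cc) ∘ₗ tt


def w12 : H ⊗[k] (H ⊗[k] H) →ₗ[k] H ⊗[k] H :=
  lTensor H ((mH k H) ∘ₗ cc) ∘ₗ lc ∘ₗ lTensor H cc

def inner12 : (H ⊗[k] H) ⊗[k] (H ⊗[k] H) →ₗ[k] H ⊗[k] H :=
  lTensor H ((mH k H) ∘ₗ cc) ∘ₗ aso ∘ₗ lTensor (H ⊗[k] H) ((mH k H) ∘ₗ cc)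

/-- `(g ⊗ i) ⊗ (b ⊗ (d ⊗ e)) ↦ g * d * e * b * i`. -/
def omegaM : (H ⊗[k] H) ⊗[k] (H ⊗[k] (H ⊗[k] H)) →ₗ[k] H :=
  (mH k H) ∘ₗ
    TensorProduct.map (mH k H) ((mH k H) ∘ₗ rTensor H (mH k H) ∘ₗ cc) ∘ₗ
    tt ∘ₗ lTensor (H ⊗[k] H) (lTensor H cc ∘ₗ lc)

variable {H U}
variable (J : H ⊗[k] U →ₗ[k] U ⊗[k] H) (T : U ⊗[k] H →ₗ[k] U ⊗[k] H)
variable (γ : U ⊗[k] U →ₗ[k] U ⊗[k] (U ⊗[k] H))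
variable (η : U ⊗[k] U →ₗ[k] U ⊗[k] (H ⊗[k] H))

variable (oneU : U)

/-- Axiom (1): `J(h ⊗ 1_U) = 1_U ⊗ h` and `J(1_H ⊗ u) = u ⊗ 1_H`. -/
def LRax1 : Prop :=
  (∀ h : H, J (h ⊗ₜ oneU) = oneU ⊗ₜ h) ∧ (∀ u : U, J ((1 : H) ⊗ₜ u) = u ⊗ₜ (1 : H))

/-- Axiom (2): `T(u ⊗ 1_H) = u ⊗ 1_H` and `T(1_U ⊗ h) = 1_U ⊗ h`. -/
def LRax2 : Prop :=
  (∀ u : U, T (u ⊗ₜ (1 : H)) = u ⊗ₜ (1 : H)) ∧ (∀ h : H, T (oneU ⊗ₜ h) = oneU ⊗ₜ h)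

/-- Axiom (3): `γ(u ⊗ 1_U) = u ⊗ 1_U ⊗ 1_H` and `γ(1_U ⊗ u) = 1_U ⊗ u ⊗ 1_H`. -/
def LRax3 : Prop :=
  (∀ u : U, γ (u ⊗ₜ oneU) = u ⊗ₜ (oneU ⊗ₜ (1 : H))) ∧
  (∀ u : U, γ (oneU ⊗ₜ u) = oneU ⊗ₜ (u ⊗ₜ (1 : H)))

/-- Axiom (4): `η(u ⊗ 1_U) = η(1_U ⊗ u) = u ⊗ 1_H ⊗ 1_H`. -/
def LRax4 : Prop :=
  (∀ u : U, η (u ⊗ₜ oneU) = u ⊗ₜ ((1 : H) ⊗ₜ (1 : H))) ∧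
  (∀ u : U, η (oneU ⊗ₜ u) = u ⊗ₜ ((1 : H) ⊗ₜ (1 : H)))

/-- Axiom (5): `u_J ⊗ (hh')_J = (u_J)_j ⊗ h_j h'_J`. -/
def LRax5 : Prop := ∀ (h h' : H) (u : U),
  J ((h * h') ⊗ₜ u) =
    lTensor U (mH k H) (aso (rTensor H J (osa (h ⊗ₜ (J (h' ⊗ₜ u))))))

/-- Axiom (6): `u_T ⊗ (hh')_T = (u_T)_t ⊗ h_T h'_t`. -/
def LRax6 : Prop := ∀ (u : U) (h h' : H),
  T (u ⊗ₜ (h * h')) =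
    lTensor U ((mH k H) ∘ₗ cc)
      (aso (rTensor H T (osa (lTensor U cc (aso ((T (u ⊗ₜ h)) ⊗ₜ h'))))))

/-- Axiom (7):
`η₁(u_J,u'_j) ⊗ η₂(u_J,u'_j)(h_J)_j ⊗ η₃(u_J,u'_j) = η₁(u,u')_J ⊗ h_J η₂(u,u') ⊗ η₃(u,u')`. -/
def LRax7 : Prop := ∀ (h : H) (u u' : U),
  lTensor U (dR k H)
      (aso (rTensor H η (osa (lTensor U J (aso ((J (h ⊗ₜ u)) ⊗ₜ u'))))))
  = lTensor U (dL k H)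
      (aso (rTensor (H ⊗[k] H) J (osa (h ⊗ₜ (η (u ⊗ₜ u'))))))

/-- Axiom (8):
`η₁(u_t,u'_T) ⊗ η₂(u_t,u'_T) ⊗ (h_T)_t η₃(u_t,u'_T) = η₁(u,u')_T ⊗ η₂(u,u') ⊗ η₃(u,u')h_T`. -/
def LRax8 : Prop := ∀ (u u' : U) (h : H),
  lTensor U (eR k H)
      (aso (rTensor H η (osa (lTensor U cc
        (aso (rTensor U T (osa (lTensor U cc (u ⊗ₜ (T (u' ⊗ₜ h)))))))))))
  = lTensor U (eL k H)
      (aso (rTensor (H ⊗[k] H) T (osa (lTensor U cc (aso ((η (u ⊗ₜ u')) ⊗ₜ h))))))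

/-- Axiom (9). -/
def LRax9 : Prop := ∀ (u u' u'' : U),
  lTensor U (mulLR k H)
      (aso (rTensor (H ⊗[k] H) η (osa (lTensor U (aso (P := H))
        ((lTensor U (rTensor H J ∘ₗ osa ∘ₗ lTensor H cc ∘ₗ aso))
          (aso ((η (u ⊗ₜ u')) ⊗ₜ u'')))))))
  = lTensor U ((mulLR k H) ∘ₗ lTensor (H ⊗[k] H) cc)
      (aso (rTensor (H ⊗[k] H) η (tt (rTensor (U ⊗[k] H) T
        (osa (lTensor U (lc ∘ₗ lTensor U cc) (u ⊗ₜ (η (u' ⊗ₜ u'')))))))))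


def qJ : (U ⊗[k] H) ⊗[k] H →ₗ[k] U ⊗[k] H :=
  lTensor U (mH k H) ∘ₗ aso ∘ₗ rTensor H J ∘ₗ osa ∘ₗ lc ∘ₗ lTensor U cc ∘ₗ aso

/-- Axiom (10). -/
def LRax10 : Prop := ∀ (u u' : U) (h : H),
  lTensor U (lTensor U ((mH k H) ∘ₗ cc))
      (aso (tt (rTensor (U ⊗[k] H) T (osa (lTensor U cc
        (aso (rTensor H γ (osa (u ⊗ₜ (J (h ⊗ₜ u')))))))))))
  = lTensor U (qJ k J)
      (aso (rTensor H γ (osa (lTensor U cc (aso ((T (u ⊗ₜ h)) ⊗ₜ u'))))))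

def psi11 : (U ⊗[k] H) ⊗[k] (H ⊗[k] H) →ₗ[k] U ⊗[k] (H ⊗[k] H) :=
  lTensor U (rTensor H (mH k H) ∘ₗ osa) ∘ₗ aso

def chainX : (U ⊗[k] H) ⊗[k] (U ⊗[k] H) →ₗ[k] U ⊗[k] (H ⊗[k] H) :=
  (lTensor U ((dR k H) ∘ₗ lTensor (H ⊗[k] H) (mH k H))) ∘ₗ aso ∘ₗ
    rTensor (H ⊗[k] H) η ∘ₗ rTensor (H ⊗[k] H) cc ∘ₗ tt ∘ₗ
    lTensor (U ⊗[k] H) cc ∘ₗ rTensor (H ⊗[k] U) J ∘ₗ rTensor (H ⊗[k] U) cc ∘ₗ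
    tt ∘ₗ lTensor (U ⊗[k] H) cc

/-- Axiom (11). -/
def LRax11 : Prop := ∀ (u u' u'' : U),
  lTensor U (psi11 k)
      (aso (tt (rTensor ((U ⊗[k] H) ⊗[k] H) T (tt (rTensor (H ⊗[k] H) γ
        (osa (u ⊗ₜ (η (u' ⊗ₜ u'')))))))))
  = lTensor U (chainX k J η)
      (aso (rTensor (U ⊗[k] H) γ (osa (lTensor U cc
        (aso ((γ (u ⊗ₜ u')) ⊗ₜ u''))))))

def chain12 : (U ⊗[k] H) ⊗[k] (H ⊗[k] H) →ₗ[k] U ⊗[k] (H ⊗[k] H) :=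
  (lTensor U (w12 k H)) ∘ₗ aso ∘ₗ tt ∘ₗ rTensor (H ⊗[k] H) J ∘ₗ
    rTensor (H ⊗[k] H) cc ∘ₗ tt ∘ₗ lTensor (U ⊗[k] H) cc

def big12 : (H ⊗[k] H) ⊗[k] (H ⊗[k] (U ⊗[k] H)) →ₗ[k] U ⊗[k] (H ⊗[k] H) :=
  lTensor U (inner12 k H) ∘ₗ lc ∘ₗ lTensor (H ⊗[k] H) lc

/-- Axiom (12). -/
def LRax12 : Prop := ∀ (u u' u'' : U),
  lTensor U (chain12 k J)
      (aso (rTensor (H ⊗[k] H) γ (osa (lTensor U cc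
        (aso ((η (u ⊗ₜ u')) ⊗ₜ u''))))))
  = lTensor U (big12 k)
      (aso (rTensor (H ⊗[k] (U ⊗[k] H)) η (tt (lTensor (U ⊗[k] H) cc
        (rTensor ((U ⊗[k] H) ⊗[k] U) T (tt (lTensor (U ⊗[k] (U ⊗[k] H)) cc
          (rTensor (U ⊗[k] H) γ (osa (lTensor U lc (u ⊗ₜ (γ (u' ⊗ₜ u'')))))))))))))

def w13 : H ⊗[k] (U ⊗[k] H) →ₗ[k] U ⊗[k] H :=
  lTensor U ((mH k H) ∘ₗ cc) ∘ₗ lc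

def xi2 : H ⊗[k] (U ⊗[k] H) →ₗ[k] U ⊗[k] H :=
  lTensor U (mH k H) ∘ₗ aso ∘ₗ rTensor H J ∘ₗ osa

def xi : H ⊗[k] (U ⊗[k] (U ⊗[k] H)) →ₗ[k] U ⊗[k] (U ⊗[k] H) :=
  lTensor U (xi2 k J) ∘ₗ lc

def rho : (U ⊗[k] H) ⊗[k] U →ₗ[k] (U ⊗[k] (U ⊗[k] H)) ⊗[k] H :=
  rTensor H γ ∘ₗ osa ∘ₗ lTensor U cc ∘ₗ aso

def chainR : ((U ⊗[k] (U ⊗[k] H)) ⊗[k] H) ⊗[k] H →ₗ[k] (U ⊗[k] H) ⊗[k] (U ⊗[k] H) :=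
  tt ∘ₗ lTensor (U ⊗[k] U) cc ∘ₗ
    lTensor (U ⊗[k] U) (rTensor H ((mH k H) ∘ₗ cc) ∘ₗ osa) ∘ₗ tt ∘ₗ
    lTensor (U ⊗[k] H) aso ∘ₗ rTensor ((U ⊗[k] H) ⊗[k] H) T ∘ₗ tt ∘ₗ
    lTensor (U ⊗[k] (U ⊗[k] H)) cc ∘ₗ aso

/-- The composite computing the right-hand side of axiom (13). -/
def rhs13 : ((H ⊗[k] (U ⊗[k] U)) ⊗[k] U) ⊗[k] H →ₗ[k]
    (U ⊗[k] (U ⊗[k] H)) ⊗[k] (U ⊗[k] H) :=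
  osa ∘ₗ lTensor U (chainR k T) ∘ₗ aso ∘ₗ
    rTensor H (lTensor U (rho k γ) ∘ₗ aso ∘ₗ rTensor U ((xi k J) ∘ₗ lTensor H γ))

/-- Axiom (13). -/
def LRax13 : Prop := ∀ (u u' u'' : U) (h h' : H),
  rTensor (U ⊗[k] H) (xi k J)
      (osa (h' ⊗ₜ (lTensor (U ⊗[k] (U ⊗[k] H)) (w13 k)
        (aso (rTensor (U ⊗[k] H) (rTensor H γ) (rTensor (U ⊗[k] H) osa
          (osa (u ⊗ₜ (rTensor (U ⊗[k] H) T (osa (lTensor U cc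
            (aso ((γ (u' ⊗ₜ u'')) ⊗ₜ h)))))))))))))
  = rhs13 k J T γ (((h' ⊗ₜ (u ⊗ₜ u')) ⊗ₜ u'') ⊗ₜ h)

/-- The L-R-crossed product multiplication, as a linear map. -/
def lrM : (U ⊗[k] H) ⊗[k] (U ⊗[k] H) →ₗ[k] U ⊗[k] H :=
  lTensor U (omegaM k H) ∘ₗ aso ∘ₗ rTensor (H ⊗[k] (H ⊗[k] H)) η ∘ₗ tt ∘ₗ
    lTensor (U ⊗[k] H) aso ∘ₗ rTensor ((U ⊗[k] H) ⊗[k] H) T ∘ₗ tt ∘ₗ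
    lTensor (U ⊗[k] (U ⊗[k] H)) cc ∘ₗ
    rTensor (H ⊗[k] H) (lTensor U J ∘ₗ lTensor U cc ∘ₗ aso) ∘ₗ tt ∘ₗ
    rTensor (H ⊗[k] H) (osa ∘ₗ γ) ∘ₗ tt

/-- The L-R-crossed product multiplication of two elements of `U ⊗ H`. -/
def lrMul (x y : U ⊗[k] H) : U ⊗[k] H := lrM k J T γ η (x ⊗ₜ y)

end LRCrossed


section TTP

variable {k : Type*} [Field k]
variable {A B : Type*} [Ring A] [Algebra k A] [Ring B] [Algebra k B]
variable (R : B ⊗[k] A →ₗ[k] A ⊗[k] B) (Q : A ⊗[k] B →ₗ[k] A ⊗[k] B)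

/-- The conditions defining an L-R-twisted tensor product `A ⊗_{Q,R} B`. -/
structure IsLRTwistedTensorProduct : Prop where
  R_one : ∀ b : B, R (b ⊗ₜ (1 : A)) = (1 : A) ⊗ₜ b
  one_R : ∀ a : A, R ((1 : B) ⊗ₜ a) = a ⊗ₜ (1 : B)
  Q_one : ∀ a : A, Q (a ⊗ₜ (1 : B)) = a ⊗ₜ (1 : B)
  one_Q : ∀ b : B, Q ((1 : A) ⊗ₜ b) = (1 : A) ⊗ₜ b
  mul_R : ∀ (a a' : A) (b : B),
    R (b ⊗ₜ (a * a')) =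
      rTensor B (LinearMap.mul' k A) (osa (lTensor A R (aso ((R (b ⊗ₜ a)) ⊗ₜ a'))))
  R_mul : ∀ (a : A) (b b' : B),
    R ((b * b') ⊗ₜ a) =
      lTensor A (LinearMap.mul' k B) (aso (rTensor B R (osa (b ⊗ₜ (R (b' ⊗ₜ a))))))
  mul_Q : ∀ (a a' : A) (b : B),
    Q ((a * a') ⊗ₜ b) =
      rTensor B (LinearMap.mul' k A) (osa (lTensor A cc (aso (rTensor A Q
        (osa (lTensor A cc (a ⊗ₜ (Q (a' ⊗ₜ b)))))))))
  Q_mul : ∀ (a : A) (b b' : B),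
    Q (a ⊗ₜ (b * b')) =
      lTensor A ((LinearMap.mul' k B) ∘ₗ cc) (aso (rTensor B Q
        (osa (lTensor A cc (aso ((Q (a ⊗ₜ b)) ⊗ₜ b'))))))
  QR_comm : ∀ (a a' : A) (b : B),
    lTensor A cc (aso (rTensor A Q (osa (lTensor A cc (a ⊗ₜ (R (b ⊗ₜ a'))))))) =
      lTensor A R (aso ((Q (a ⊗ₜ b)) ⊗ₜ a'))
  RQ_comm : ∀ (a' : A) (b b' : B),
    aso (rTensor B R (osa (b' ⊗ₜ (Q (a' ⊗ₜ b))))) =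
      lTensor A cc (aso (rTensor B Q (osa (lTensor A cc (aso ((R (b' ⊗ₜ a')) ⊗ₜ b))))))

end TTP


section PureTensors

variable {k : Type*} [Field k] {M N P Q : Type*}
  [AddCommMonoid M] [AddCommMonoid N] [AddCommMonoid P] [AddCommMonoid Q]
  [Module k M] [Module k N] [Module k P] [Module k Q]

theorem aso_tmul (m : M) (n : N) (p : P) :
    aso (k := k) ((m ⊗ₜ n) ⊗ₜ p) = m ⊗ₜ (n ⊗ₜ p) := rfl

theorem osa_tmul (m : M) (n : N) (p : P) :
    osa (k := k) (m ⊗ₜ (n ⊗ₜ p)) = (m ⊗ₜ n) ⊗ₜ p := rfl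

theorem cc_tmul (m : M) (n : N) : cc (k := k) (m ⊗ₜ n) = n ⊗ₜ m := rfl

theorem tt_tmul (m : M) (n : N) (p : P) (q : Q) :
    tt (k := k) ((m ⊗ₜ n) ⊗ₜ (p ⊗ₜ q)) = (m ⊗ₜ p) ⊗ₜ (n ⊗ₜ q) := rfl

end PureTensors

section LRTwisted

variable {k : Type*} [Field k]
variable {A B : Type*} [Ring A] [Algebra k A] [Ring B] [Algebra k B]
variable (R : B ⊗[k] A →ₗ[k] A ⊗[k] B) (Q : A ⊗[k] B →ₗ[k] A ⊗[k] B)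

variable (k A B) in
/-- The multiplication `(a ⊗ b) ⊗ (a' ⊗ b') ↦ a * a' ⊗ b' * b` of `A ⊗ Bᵒᵖ`. -/
def mulOpRight : (A ⊗[k] B) ⊗[k] (A ⊗[k] B) →ₗ[k] A ⊗[k] B :=
  TensorProduct.map (LinearMap.mul' k A) ((LinearMap.mul' k B) ∘ₗ cc) ∘ₗ tt

theorem mulOpRight_tmul (a a' : A) (b b' : B) :
    mulOpRight k A B ((a ⊗ₜ b) ⊗ₜ (a' ⊗ₜ b')) = (a * a') ⊗ₜ (b' * b) := rfl

/-- The L-R-twisted multiplication `(a ⊗ b) ⊗ (a' ⊗ b') ↦ a_Q * a'_R ⊗ b_R * b'_Q`. -/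
def lrTwistedMul : (A ⊗[k] B) ⊗[k] (A ⊗[k] B) →ₗ[k] A ⊗[k] B :=
  mulOpRight k A B ∘ₗ TensorProduct.map Q R ∘ₗ tt ∘ₗ lTensor (A ⊗[k] B) cc

theorem lrTwistedMul_tmul (a a' : A) (b b' : B) :
    lrTwistedMul R Q ((a ⊗ₜ b) ⊗ₜ (a' ⊗ₜ b')) =
      mulOpRight k A B (Q (a ⊗ₜ b') ⊗ₜ R (b ⊗ₜ a')) := rfl

/-- `(a ⊗ a'' ⊗ b') ⊗ (a' ⊗ b ⊗ b'') ↦ a_Q * a' * a''_R ⊗ b_R * b' * b''_Q`. -/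
def lrTwistedMulThree :
    (A ⊗[k] (A ⊗[k] B)) ⊗[k] (A ⊗[k] (B ⊗[k] B)) →ₗ[k] A ⊗[k] B :=
  mulOpRight k A B ∘ₗ
    TensorProduct.map Q
      (mulOpRight k A B ∘ₗ lTensor (A ⊗[k] B) R ∘ₗ tt ∘ₗ lTensor (A ⊗[k] B) cc ∘ₗ cc) ∘ₗ
    tt ∘ₗ lTensor (A ⊗[k] (A ⊗[k] B)) (cc ∘ₗ osa)

theorem lrTwistedMulThree_tmul (a a' a'' : A) (b b' b'' : B) :
    lrTwistedMulThree R Q ((a ⊗ₜ (a'' ⊗ₜ b')) ⊗ₜ (a' ⊗ₜ (b ⊗ₜ b''))) =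
      mulOpRight k A B (Q (a ⊗ₜ b'') ⊗ₜ
        mulOpRight k A B ((a' ⊗ₜ b') ⊗ₜ R (b ⊗ₜ a''))) := rfl

variable {R Q}

theorem lrTwistedMul_mulOpRight_left (hQR : IsLRTwistedTensorProduct R Q)
    (x y : A ⊗[k] B) (a : A) (b : B) :
    lrTwistedMul R Q (mulOpRight k A B (x ⊗ₜ y) ⊗ₜ (a ⊗ₜ b)) =
      lrTwistedMulThree R Q
        (lTensor A R (aso (x ⊗ₜ a)) ⊗ₜ
          lTensor A cc (aso (rTensor B Q (osa (lTensor A cc (aso (y ⊗ₜ b))))))) := by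
  induction x with
  | zero => simp
  | add x x' hx hx' => simp only [add_tmul, map_add, hx, hx']
  | tmul p t =>
  induction y with
  | zero => simp
  | add y y' hy hy' => simp only [add_tmul, tmul_add, map_add, hy, hy']
  | tmul u v =>
  simp only [mulOpRight_tmul, lrTwistedMul_tmul, hQR.mul_Q, hQR.R_mul, aso_tmul, osa_tmul,
    cc_tmul, lTensor_tmul, rTensor_tmul]
  generalize Q (u ⊗ₜ b) = z
  generalize R (t ⊗ₜ a) = w
  induction z with
  | zero => simp
  | add z z' hz hz' => simp only [add_tmul, tmul_add, map_add, hz, hz']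
  | tmul u' d =>
  induction w with
  | zero => simp
  | add w w' hw hw' => simp only [add_tmul, tmul_add, map_add, hw, hw']
  | tmul s t' =>
  simp only [lrTwistedMulThree_tmul, aso_tmul, osa_tmul, cc_tmul, lTensor_tmul, rTensor_tmul]
  generalize Q (p ⊗ₜ d) = z
  generalize R (v ⊗ₜ s) = w
  induction z with
  | zero => simp
  | add z z' hz hz' => simp only [add_tmul, map_add, hz, hz']
  | tmul c d =>
  induction w with
  | zero => simp
  | add w w' hw hw' => simp only [add_tmul, tmul_add, map_add, hw, hw']
  | tmul e f =>
  simp [mulOpRight_tmul, aso_tmul, osa_tmul, cc_tmul, mul_assoc]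

theorem lrTwistedMul_mulOpRight_right (hQR : IsLRTwistedTensorProduct R Q)
    (x y : A ⊗[k] B) (a : A) (b : B) :
    lrTwistedMul R Q ((a ⊗ₜ b) ⊗ₜ mulOpRight k A B (x ⊗ₜ y)) =
      lrTwistedMulThree R Q
        (lTensor A cc (aso (rTensor A Q (osa (lTensor A cc (a ⊗ₜ y))))) ⊗ₜ
          aso (rTensor B R (osa (b ⊗ₜ x)))) := by
  induction x with
  | zero => simp
  | add x x' hx hx' => simp only [add_tmul, tmul_add, map_add, hx, hx']
  | tmul p t =>
  induction y with
  | zero => simp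
  | add y y' hy hy' => simp only [add_tmul, tmul_add, map_add, hy, hy']
  | tmul u v =>
  simp only [mulOpRight_tmul, lrTwistedMul_tmul, hQR.Q_mul, hQR.mul_R, osa_tmul,
    cc_tmul, lTensor_tmul, rTensor_tmul]
  generalize Q (a ⊗ₜ v) = z
  generalize R (b ⊗ₜ p) = w
  induction z with
  | zero => simp
  | add z z' hz hz' => simp only [add_tmul, map_add, hz, hz']
  | tmul a' v' =>
  induction w with
  | zero => simp
  | add w w' hw hw' => simp only [add_tmul, tmul_add, map_add, hw, hw']
  | tmul p' b' =>
  simp only [lrTwistedMulThree_tmul, aso_tmul, osa_tmul, cc_tmul, lTensor_tmul, rTensor_tmul]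
  generalize Q (a' ⊗ₜ t) = z
  generalize R (b' ⊗ₜ u) = w
  induction z with
  | zero => simp
  | add z z' hz hz' => simp only [add_tmul, map_add, hz, hz']
  | tmul c d =>
  induction w with
  | zero => simp
  | add w w' hw hw' => simp only [tmul_add, map_add, hw, hw']
  | tmul e f =>
  simp [mulOpRight_tmul, aso_tmul, osa_tmul, cc_tmul, mul_assoc]

theorem lrTwistedMul_assoc (hQR : IsLRTwistedTensorProduct R Q) (x y z : A ⊗[k] B) :
    lrTwistedMul R Q (lrTwistedMul R Q (x ⊗ₜ y) ⊗ₜ z) =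
      lrTwistedMul R Q (x ⊗ₜ lrTwistedMul R Q (y ⊗ₜ z)) := by
  induction x with
  | zero => simp
  | add x x' hx hx' => simp only [add_tmul, map_add, hx, hx']
  | tmul a b =>
  induction y with
  | zero => simp
  | add y y' hy hy' => simp only [add_tmul, tmul_add, map_add, hy, hy']
  | tmul a' b' =>
  induction z with
  | zero => simp
  | add z z' hz hz' => simp only [tmul_add, map_add, hz, hz']
  | tmul a'' b'' =>
  rw [lrTwistedMul_tmul, lrTwistedMul_tmul, lrTwistedMul_mulOpRight_left hQR,
    lrTwistedMul_mulOpRight_right hQR, hQR.QR_comm, hQR.RQ_comm]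

theorem one_lrTwistedMul (hQR : IsLRTwistedTensorProduct R Q) (x : A ⊗[k] B) :
    lrTwistedMul R Q (((1 : A) ⊗ₜ (1 : B)) ⊗ₜ x) = x := by
  induction x with
  | zero => simp
  | add x y hx hy => rw [tmul_add, map_add, hx, hy]
  | tmul a b => simp [lrTwistedMul_tmul, hQR.one_Q, hQR.one_R, mulOpRight_tmul]

theorem lrTwistedMul_one (hQR : IsLRTwistedTensorProduct R Q) (x : A ⊗[k] B) :
    lrTwistedMul R Q (x ⊗ₜ ((1 : A) ⊗ₜ (1 : B))) = x := by
  induction x with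
  | zero => simp
  | add x y hx hy => rw [add_tmul, map_add, hx, hy]
  | tmul a b => simp [lrTwistedMul_tmul, hQR.Q_one, hQR.R_one, mulOpRight_tmul]

end LRTwisted

/-- If `R`, `Q` satisfy the L-R-twisted tensor product conditions, then the
L-R-twisted tensor product `A ⊗_{Q,R} B`, i.e. `A ⊗ B` with the (bilinear) multiplication
determined by `(a⊗b)(a'⊗b') = a_Q a'_R ⊗ b_R b'_Q`, is an associative unital algebra with
unit `1_A ⊗ 1_B`. -/
theorem lr_twisted_tensor_product_is_unital_associative_algebra
    {k : Type*} [Field k] {A B : Type*} [Ring A] [Algebra k A] [Ring B] [Algebra k B]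
    (R : B ⊗[k] A →ₗ[k] A ⊗[k] B) (Q : A ⊗[k] B →ₗ[k] A ⊗[k] B)
    (hQR : IsLRTwistedTensorProduct R Q) :
    ∃ mul : A ⊗[k] B →ₗ[k] A ⊗[k] B →ₗ[k] A ⊗[k] B,
      (∀ (a a' : A) (b b' : B),
        mul (a ⊗ₜ b) (a' ⊗ₜ b') =
          TensorProduct.map (LinearMap.mul' k A) ((LinearMap.mul' k B) ∘ₗ cc)
            (tt ((Q (a ⊗ₜ b')) ⊗ₜ (R (b ⊗ₜ a'))))) ∧
      (∀ x y z : A ⊗[k] B, mul (mul x y) z = mul x (mul y z)) ∧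
      (∀ x : A ⊗[k] B, mul ((1 : A) ⊗ₜ (1 : B)) x = x) ∧
      (∀ x : A ⊗[k] B, mul x ((1 : A) ⊗ₜ (1 : B)) = x) := by
  exact ⟨TensorProduct.curry (lrTwistedMul R Q), fun _ _ _ _ => rfl,
    lrTwistedMul_assoc hQR, one_lrTwistedMul hQR, lrTwistedMul_one hQR⟩
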